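/- arXiv:1406.5147 — 2 statements merged into one kernel-verified Lean document; each statement's English description precedes it below -/
import Mathlib

section
/- Let G be a ribbon graph (finite connected loopless multigraph with a cyclic ordering of edges at each vertex), let T be a spanning tree of G, let v be any vertex, and let [D] ∈ Jac(G). Then the angle based at v between T and the tree [D]·T obtained by the rotor-routing action with basepoint v satisfies ∠_v(T, [D]·T) = [−D] in Jac(G). -/
attribute [local instance 10] Classical.propDecidable

/-- A finite multigraph, presented by darts (oriented edges): `rev` is the
fixed-point-free involution exchanging the two darts of each edge, and
`head d` is the vertex the dart `d` points to. -/
structure Multigraph where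
  V : Type
  D : Type
  fV : Fintype V
  dV : DecidableEq V
  fD : Fintype D
  dD : DecidableEq D
  rev : D → D
  rev_invol : Function.Involutive rev
  rev_ne : ∀ d : D, rev d ≠ d
  head : D → V

attribute [instance] Multigraph.fV Multigraph.dV Multigraph.fD Multigraph.dD

namespace Multigraph

variable (G : Multigraph)

/-- The tail (starting vertex) of a dart. -/
def tail (d : G.D) : G.V := G.head (G.rev d)

/-- `G` is loopless: no edge has equal endpoints. -/
def Loopless : Prop := ∀ d : G.D, G.head d ≠ G.tail d

/-- One-step adjacency between vertices. -/
def Adj (u v : G.V) : Prop := ∃ d : G.D, G.tail d = u ∧ G.head d = v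

/-- `G` is connected. -/
def Connected : Prop := ∀ u v : G.V, Relation.ReflTransGen G.Adj u v

/-- The degree of a vertex: the number of darts with tail `v`. -/
def degree (v : G.V) : ℕ := (Finset.univ.filter fun d : G.D => G.tail d = v).card

/-- The number of edges joining `v` to `w`. -/
def mul (v w : G.V) : ℕ :=
  (Finset.univ.filter fun d : G.D => G.tail d = v ∧ G.head d = w).card

/-! ### Divisors and the sandpile group -/

/-- The total degree homomorphism on divisors. -/
def degHom : (G.V → ℤ) →+ ℤ where
  toFun x := ∑ v, x v
  map_zero' := by simp
  map_add' x y := by simp [Finset.sum_add_distrib]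

/-- Degree-zero divisors. -/
def Div0 : AddSubgroup (G.V → ℤ) := G.degHom.ker

/-- The principal divisor of a lending move at `v`: `v` loses `deg v` chips and
each other vertex `w` gains `n(v,w)` chips. -/
def prin (v : G.V) : G.V → ℤ :=
  fun w => if w = v then -(G.degree v : ℤ) else (G.mul v w : ℤ)

/-- The subgroup of `ℤV` generated by all lending moves. -/
def Prin : AddSubgroup (G.V → ℤ) := AddSubgroup.closure (Set.range G.prin)

/-- Two divisors are linearly equivalent when they differ by a sequence of
lending moves. -/
def LinEquiv (D D' : G.V → ℤ) : Prop := D' - D ∈ G.Prin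

/-- The sandpile group (Jacobian) of `G`: degree-zero divisors modulo
linear equivalence. -/
def Jac := G.Div0 ⧸ (G.Prin.addSubgroupOf G.Div0)

instance : AddCommGroup G.Jac :=
  inferInstanceAs (AddCommGroup (G.Div0 ⧸ (G.Prin.addSubgroupOf G.Div0)))

/-- The divisor class of a degree-zero divisor in the sandpile group. -/
def divClass (D : G.Div0) : G.Jac := QuotientAddGroup.mk D

/-- The divisor `a - b` for vertices `a`, `b`. -/
def unitDivFun (a b : G.V) : G.V → ℤ :=
  fun w => (if w = a then 1 else 0) - (if w = b then 1 else 0)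

lemma unitDivFun_mem (a b : G.V) : G.unitDivFun a b ∈ G.Div0 := by
  simp [Div0, degHom, AddMonoidHom.mem_ker, unitDivFun, Finset.sum_sub_distrib]

/-- The divisor `a - b` as a degree-zero divisor. -/
def unitDiv (a b : G.V) : G.Div0 := ⟨G.unitDivFun a b, G.unitDivFun_mem a b⟩

/-- The class `[a - b] ∈ Jac(G)`. -/
def unitClass (a b : G.V) : G.Jac := G.divClass (G.unitDiv a b)

/-- The boundary of a dart: `∂ d = [d⁺ - d⁻] ∈ Jac(G)`. -/
def dartBoundary (d : G.D) : G.Jac := G.unitClass (G.head d) (G.tail d)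

/-! ### The group ℤE of formal sums of oriented edges -/

/-- `ℤE`: functions on darts that are antisymmetric under reversal;
this is the free abelian group on the oriented edges, with `-e` identified
with the oppositely oriented edge. -/
def EdgeGroup : AddSubgroup (G.D → ℤ) where
  carrier := {x | ∀ d, x (G.rev d) = -x d}
  add_mem' := by
    intro a b ha hb d
    simp only [Pi.add_apply, ha d, hb d]
    ring
  zero_mem' := by intro d; simp
  neg_mem' := by
    intro a ha d
    simp only [Pi.neg_apply, ha d]

/-- The element of `ℤE` corresponding to a single oriented edge (dart). -/
def dartVec (d : G.D) : G.D → ℤ :=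
  fun d' => if d' = d then 1 else if d' = G.rev d then -1 else 0

lemma dartVec_mem (d : G.D) : G.dartVec d ∈ G.EdgeGroup := by
  have hinj := G.rev_invol.injective
  intro d'
  unfold dartVec
  rcases eq_or_ne d' d with rfl | h1
  · simp [G.rev_ne d']
  · rcases eq_or_ne d' (G.rev d) with rfl | h2
    · simp [G.rev_invol d, G.rev_ne d]
    · have h3 : G.rev d' ≠ d := fun h => h2 (by rw [← h, G.rev_invol])
      have h4 : G.rev d' ≠ G.rev d := fun h => h1 (hinj h)
      simp [h1, h2, h3, h4]

/-- The vector of a list of darts (e.g. of a directed cycle). -/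
def listVec (l : List G.D) : G.D → ℤ := (l.map G.dartVec).sum

/-- `l` is a directed cycle: a nonempty closed walk of darts through
pairwise distinct vertices. -/
def IsDirCycle (l : List G.D) : Prop :=
  l ≠ [] ∧ l.Chain' (fun a b => G.head a = G.tail b) ∧
    (∀ a ∈ l.getLast?, ∀ b ∈ l.head?, G.head a = G.tail b) ∧
    (l.map G.tail).Nodup

/-- The integral cycle space `𝒞 ⊆ ℤE`. -/
def CycleSpace : AddSubgroup (G.D → ℤ) :=
  AddSubgroup.closure {x | ∃ l : List G.D, G.IsDirCycle l ∧ x = G.listVec l}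

/-- The cut determined by a set `U` of vertices, directed out of `U`. -/
def cutVec (U : Finset G.V) : G.D → ℤ := fun d =>
  if G.tail d ∈ U ∧ G.head d ∉ U then 1
  else if G.head d ∈ U ∧ G.tail d ∉ U then -1 else 0

/-- The integral cut space `𝒞* ⊆ ℤE`. -/
def CutSpace : AddSubgroup (G.D → ℤ) :=
  AddSubgroup.closure (Set.range G.cutVec)

/-- `ℰ(G) = ℤE / (𝒞 + 𝒞*)`. -/
def EGroup :=
  G.EdgeGroup ⧸ ((G.CycleSpace ⊔ G.CutSpace).addSubgroupOf G.EdgeGroup)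

instance : AddCommGroup G.EGroup :=
  inferInstanceAs
    (AddCommGroup (G.EdgeGroup ⧸ ((G.CycleSpace ⊔ G.CutSpace).addSubgroupOf G.EdgeGroup)))

/-- The class of an oriented edge in `ℰ(G)`. -/
def eClass (d : G.D) : G.EGroup :=
  QuotientAddGroup.mk ⟨G.dartVec d, G.dartVec_mem d⟩

/-- The boundary map `ℤE → ℤV`, sending an oriented edge `e` to `e⁺ - e⁻`
(when restricted to `ℤE ⊆ (D → ℤ)`). -/
def bMap : (G.D → ℤ) →+ (G.V → ℤ) where
  toFun x := fun v => ∑ d ∈ Finset.univ.filter (fun d => G.head d = v), x d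
  map_zero' := by funext v; simp
  map_add' x y := by funext v; simp [Finset.sum_add_distrib]

/-! ### Spanning trees -/

/-- Adjacency using only darts in `T`. -/
def treeAdj (T : Finset G.D) (u v : G.V) : Prop :=
  ∃ d ∈ T, G.tail d = u ∧ G.head d = v

/-- `T` (a reversal-closed set of darts) is a spanning tree: it is connected,
meets every vertex, and has exactly `|V| - 1` edges (hence is acyclic). -/
def IsSpanningTree (T : Finset G.D) : Prop :=
  (∀ d ∈ T, G.rev d ∈ T) ∧
    (∀ u v : G.V, Relation.ReflTransGen (G.treeAdj T) u v) ∧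
    T.card = 2 * (Fintype.card G.V - 1)

/-- The reversal involution as a permutation of darts. -/
def revPerm : Equiv.Perm G.D := Function.Involutive.toPerm G.rev G.rev_invol

end Multigraph

/-- A ribbon graph: a multigraph together with, at each vertex, a cyclic
ordering of the incident edges (darts).  `next d` is the dart following `d`
in the cyclic order at the tail of `d`. -/
structure RibbonGraph extends Multigraph where
  next : Equiv.Perm toMultigraph.D
  next_tail : ∀ d : toMultigraph.D, toMultigraph.tail (next d) = toMultigraph.tail d
  next_cyclic : ∀ d d' : toMultigraph.D,
    toMultigraph.tail d = toMultigraph.tail d' → next.SameCycle d d'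

namespace RibbonGraph

variable (G : RibbonGraph)

/-- The face permutation of a ribbon graph; its orbits are the faces of the
associated surface embedding (the orbit of a dart `d` is the face to the left
of `d`, when the cyclic orders are taken clockwise). -/
def facePerm : Equiv.Perm G.D := G.next * G.revPerm

/-- Darts lie in the same face when they are in the same orbit of the face
permutation. -/
def faceSetoid : Setoid G.D :=
  ⟨G.facePerm.SameCycle,
    ⟨fun x => Equiv.Perm.SameCycle.refl _ x, fun h => h.symm, fun h h' => h.trans h'⟩⟩

/-- The faces of the surface embedding determined by the ribbon structure. -/
def Faces := Quotient G.faceSetoid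

instance : Fintype G.Faces :=
  @Quotient.fintype _ _ G.faceSetoid
    (fun a b => inferInstanceAs (Decidable (G.facePerm.SameCycle a b)))

/-- The face to the left of a dart. -/
def leftFace (d : G.D) : G.Faces := Quotient.mk G.faceSetoid d

/-- The face to the right of a dart. -/
def rightFace (d : G.D) : G.Faces := G.leftFace (G.rev d)

/-- `G` is a planar ribbon graph: the surface it embeds in has genus `0`,
i.e. Euler's formula `|V| - |E| + |F| = 2` holds. -/
def IsPlanar : Prop :=
  Fintype.card G.V + Fintype.card G.Faces = Fintype.card G.D / 2 + 2

/-! ### Rotor-routing -/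

/-- A rotor configuration with basepoint `q`: a choice, for each vertex
`v ≠ q`, of a dart with tail `v`. -/
def RotorConfig (q : G.V) :=
  {ρ : (v : G.V) → v ≠ q → G.D // ∀ (v : G.V) (h : v ≠ q), G.tail (ρ v h) = v}

/-- Firing the vertex `v ≠ q` in a state (chip configuration, rotor
configuration): the rotor at `v` advances to the next dart in the cyclic
order at `v`, and one chip moves from `v` to the head of the new rotor. -/
def fire (q : G.V) (v : G.V) (hv : v ≠ q) (s : (G.V → ℤ) × G.RotorConfig q) :
    (G.V → ℤ) × G.RotorConfig q :=
  ((fun w => s.1 w - (if w = v then 1 else 0) +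
      (if w = G.head (G.next (s.2.1 v hv)) then 1 else 0)),
   ⟨fun u hu => if u = v then G.next (s.2.1 v hv) else s.2.1 u hu, by
      intro u hu
      by_cases h : u = v
      · simp only [if_pos h]
        rw [G.next_tail, s.2.2 v hv, h]
      · simp only [if_neg h]
        exact s.2.2 u hu⟩)

/-- A single legal rotor-routing step: fire some vertex `v ≠ q` carrying at
least one chip. -/
def Step (q : G.V) (s s' : (G.V → ℤ) × G.RotorConfig q) : Prop :=
  ∃ (v : G.V) (hv : v ≠ q), 1 ≤ s.1 v ∧ s' = G.fire q v hv s

/-- A state is terminal when no vertex other than `q` can be fired. -/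
def Terminal (q : G.V) (s : (G.V → ℤ) × G.RotorConfig q) : Prop :=
  ∀ v : G.V, v ≠ q → s.1 v ≤ 0

/-- `ρ` is the rotor configuration obtained by orienting the spanning tree
`T` towards the root `q`: every rotor is a dart of `T`, and following the
rotors from any vertex leads to `q`. -/
def TowardRoot (q : G.V) (T : Finset G.D) (ρ : G.RotorConfig q) : Prop :=
  ∀ (v : G.V) (h : v ≠ q), ρ.1 v h ∈ T ∧
    Relation.ReflTransGen (fun a b => ∃ ha : a ≠ q, G.head (ρ.1 a ha) = b) v q

/-- The rotor-routing process started from a representative of `x` that is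
nonnegative away from `q` and from the rotor configuration of `T` oriented
towards `q` terminates at the rotor configuration of `T'` oriented towards
`q`. -/
def ActsTo (q : G.V) (x : G.Jac) (T T' : Finset G.D) : Prop :=
  ∃ D : G.Div0, G.divClass D = x ∧ (∀ v : G.V, v ≠ q → 0 ≤ (D : G.V → ℤ) v) ∧
    ∃ (ρ ρ' : G.RotorConfig q) (c' : G.V → ℤ),
      G.TowardRoot q T ρ ∧ G.TowardRoot q T' ρ' ∧
      Relation.ReflTransGen (G.Step q) ((D : G.V → ℤ), ρ) (c', ρ') ∧
      G.Terminal q (c', ρ')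

/-- The rotor-routing action of the sandpile group element `x` on the
spanning tree `T`, with basepoint `q`. -/
noncomputable def rotorAction (q : G.V) (x : G.Jac) (T : Finset G.D) :
    Finset G.D :=
  if h : ∃ T' : Finset G.D, G.IsSpanningTree T' ∧ G.ActsTo q x T T' then
    h.choose
  else T

/-! ### Angles -/

/-- The angle `∠ᵘ(d, d')` between two darts with the same tail `u`:
if `d = e₀, e₁, …, e_k = d'` are the consecutive darts in the cyclic order
at `u`, the angle is `∑_{i=1}^{k} ∂ eᵢ ∈ Jac(G)`. -/
noncomputable def dartAngle (d d' : G.D) : G.Jac :=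
  if h : ∃ k : ℕ, (⇑G.next)^[k] d = d' then
    ∑ i ∈ Finset.range (Nat.find h), G.dartBoundary ((⇑G.next)^[i + 1] d)
  else 0

/-- The angle `∠_v(T, T')` between two spanning trees `T, T'` based at `v`:
the sum over all vertices `u ≠ v` of the angles between the rotors of `T`
and of `T'` at `u` (both oriented towards `v`). -/
noncomputable def treeAngle (v : G.V) (T T' : Finset G.D) : G.Jac :=
  if h : ∃ p : G.RotorConfig v × G.RotorConfig v,
      G.TowardRoot v T p.1 ∧ G.TowardRoot v T' p.2 then
    ∑ u : G.V,
      if hu : u = v then 0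
      else G.dartAngle (h.choose.1.1 u hu) (h.choose.2.1 u hu)
  else 0


/-! ### The planar dual ribbon graph -/

/-- The dual ribbon graph `G*` of a ribbon graph `G`: its vertices are the
faces of `G`, its darts are the darts of `G`, where the dart `d`, viewed in
the dual, crosses `d` from the face after `d` (its right, its dual tail) to
the face before `d` (its left, its dual head), and the cyclic orders at the
faces are the counter-clockwise ones. -/
noncomputable def dual : RibbonGraph where
  V := G.Faces
  D := G.D
  fV := inferInstance
  dV := Classical.decEq _
  fD := G.fD
  dD := G.dD
  rev := G.rev
  rev_invol := G.rev_invol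
  rev_ne := G.rev_ne
  head := fun d => G.leftFace d
  next := G.revPerm * G.facePerm * G.revPerm
  next_tail := by
    intro d
    show G.leftFace (G.rev (G.rev (G.facePerm (G.rev d)))) = G.leftFace (G.rev d)
    rw [G.rev_invol]
    exact Quotient.sound ⟨-1, by simp⟩
  next_cyclic := by
    intro d d' h
    have h1 : G.facePerm.SameCycle (G.rev d) (G.rev d') := Quotient.exact h
    have h2 := h1.conj (g := G.revPerm)
    have hR : G.revPerm⁻¹ = G.revPerm := by
      rw [Equiv.Perm.inv_def]
      exact Function.Involutive.toPerm_symm G.rev_invol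
    rw [hR] at h2
    have e1 : G.revPerm (G.rev d) = d := G.rev_invol d
    have e2 : G.revPerm (G.rev d') = d' := G.rev_invol d'
    rw [e1, e2] at h2
    exact h2


end RibbonGraph

namespace Multigraph

variable (G : Multigraph)

/-- The boundary of a dart as a degree-zero divisor. -/
def dartDiv (d : G.D) : G.Div0 := G.unitDiv (G.head d) (G.tail d)

/-- The quotient homomorphism onto the sandpile group. -/
def jacMk : G.Div0 →+ G.Jac := QuotientAddGroup.mk' (G.Prin.addSubgroupOf G.Div0)

lemma jacMk_dartDiv (d : G.D) : G.jacMk (G.dartDiv d) = G.dartBoundary d := rfl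

lemma jacMk_surjective : Function.Surjective G.jacMk :=
  QuotientAddGroup.mk'_surjective _

lemma jacMk_eq_zero {D : G.Div0} (h : (D : G.V → ℤ) ∈ G.Prin) : G.jacMk D = 0 :=
  (QuotientAddGroup.eq_zero_iff D).2 (AddSubgroup.mem_addSubgroupOf.2 h)

lemma head_rev (d : G.D) : G.head (G.rev d) = G.tail d := rfl

lemma tail_rev (d : G.D) : G.tail (G.rev d) = G.head d := by
  rw [tail, G.rev_invol]

lemma dartDiv_apply (d : G.D) (w : G.V) :
    (G.dartDiv d : G.V → ℤ) w =
      (if w = G.head d then 1 else 0) - (if w = G.tail d then 1 else 0) := rfl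

lemma sum_dartDiv_tail (hloop : G.Loopless) (v : G.V) :
    ((∑ d ∈ Finset.univ.filter (fun d : G.D => G.tail d = v), G.dartDiv d : G.Div0) :
      G.V → ℤ) = G.prin v := by
  funext w
  rw [AddSubgroup.val_finsetSum, Finset.sum_apply]
  simp only [dartDiv_apply, Finset.sum_sub_distrib]
  unfold prin degree mul
  have h2 : ∑ d ∈ Finset.univ.filter (fun d : G.D => G.tail d = v),
      (if w = G.tail d then (1 : ℤ) else 0) =
      if w = v then ((Finset.univ.filter (fun d : G.D => G.tail d = v)).card : ℤ) else 0 := by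
    rw [Finset.sum_congr rfl (g := fun _ => if w = v then (1 : ℤ) else 0)]
    · split_ifs <;> simp
    · intro d hd
      rw [(Finset.mem_filter.1 hd).2]
  have h1 : ∑ d ∈ Finset.univ.filter (fun d : G.D => G.tail d = v),
      (if w = G.head d then (1 : ℤ) else 0) =
      ((Finset.univ.filter (fun d : G.D => G.tail d = v ∧ G.head d = w)).card : ℤ) := by
    rw [Finset.sum_boole, Finset.filter_filter]
    simp only [eq_comm (a := w)]
  rw [h1, h2]
  split_ifs with h
  · subst h
    rw [Finset.filter_false_of_mem]
    · simp
    · rintro d - ⟨h3, h4⟩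
      exact hloop d (h4.trans h3.symm)
  · simp

lemma prin_mem_Div0 (hloop : G.Loopless) (v : G.V) : G.prin v ∈ G.Div0 := by
  rw [← G.sum_dartDiv_tail hloop v]
  exact Subtype.coe_prop _

lemma sum_dartBoundary_tail (hloop : G.Loopless) (v : G.V) :
    ∑ d ∈ Finset.univ.filter (fun d : G.D => G.tail d = v), G.dartBoundary d = 0 := by
  simp only [← jacMk_dartDiv]
  rw [← map_sum]
  apply jacMk_eq_zero
  rw [G.sum_dartDiv_tail hloop]
  exact AddSubgroup.subset_closure ⟨v, rfl⟩

/-- `v` is joined to `q` by a path of `n` darts of `T`. -/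
def PathLength (q : G.V) (T : Finset G.D) : ℕ → G.V → Prop
  | 0, v => v = q
  | n + 1, v => ∃ d ∈ T, G.tail d = v ∧ PathLength q T n (G.head d)

lemma exists_rank (q : G.V) (T : Finset G.D)
    (hT : ∀ u v : G.V, Relation.ReflTransGen (G.treeAdj T) u v) :
    ∃ f : G.V → ℕ, ∀ v, v ≠ q → ∃ d ∈ T, G.tail d = v ∧ f (G.head d) < f v := by
  have hex : ∀ v, ∃ n, G.PathLength q T n v := by
    intro v
    induction hT v q using Relation.ReflTransGen.head_induction_on with
    | refl => exact ⟨0, rfl⟩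
    | head h _ ih =>
      obtain ⟨d, hd, rfl, rfl⟩ := h
      obtain ⟨n, hn⟩ := ih
      exact ⟨n + 1, d, hd, rfl, hn⟩
  refine ⟨fun v => Nat.find (hex v), fun v hv => ?_⟩
  have h := Nat.find_spec (hex v)
  obtain ⟨n, hn⟩ : ∃ n, Nat.find (hex v) = n + 1 := by
    refine Nat.exists_eq_succ_of_ne_zero fun h0 => hv ?_
    rw [h0] at h
    exact h
  rw [hn] at h
  obtain ⟨d, hd, hdv, hp⟩ := h
  refine ⟨d, hd, hdv, ?_⟩
  have := Nat.find_min' (hex (G.head d)) hp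
  dsimp only
  omega

lemma sum_prin_apply_nonneg (S : Finset G.V) {w : G.V} (hw : w ∉ S) :
    0 ≤ (∑ u ∈ S, G.prin u) w := by
  rw [Finset.sum_apply]
  refine Finset.sum_nonneg fun u hu => ?_
  rw [prin, if_neg (ne_of_mem_of_not_mem hu hw).symm]
  positivity

lemma sum_prin_apply_pos (S : Finset G.V) {w : G.V} (hw : w ∉ S) (d : G.D)
    (hd : G.tail d = w) (hdS : G.head d ∈ S) : 1 ≤ (∑ u ∈ S, G.prin u) w := by
  rw [Finset.sum_apply]
  have hterm : ∀ u ∈ S, 0 ≤ G.prin u w := by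
    intro u hu
    rw [prin, if_neg (ne_of_mem_of_not_mem hu hw).symm]
    positivity
  refine le_trans ?_ (Finset.single_le_sum hterm hdS)
  rw [prin, if_neg (ne_of_mem_of_not_mem hdS hw).symm, mul]
  have : 0 < (Finset.univ.filter
      fun e : G.D => G.tail e = G.head d ∧ G.head e = w).card :=
    Finset.card_pos.2 ⟨G.rev d, by simp [tail_rev, head_rev, hd]⟩
  exact_mod_cast this

/-- Every divisor class has a representative that is effective away from `q`. -/
lemma exists_nonneg_representative (hloop : G.Loopless) (q : G.V) (T : Finset G.D)
    (hT : ∀ u v : G.V, Relation.ReflTransGen (G.treeAdj T) u v) (x : G.Jac) :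
    ∃ D : G.Div0, G.divClass D = x ∧ ∀ v : G.V, v ≠ q → 0 ≤ (D : G.V → ℤ) v := by
  obtain ⟨f, hf⟩ := G.exists_rank q T hT
  have key : ∀ n j : ℕ, (∀ v, f v < n + j) →
      ∃ D : G.Div0, G.jacMk D = x ∧ ∀ v, v ≠ q → j ≤ f v → 0 ≤ (D : G.V → ℤ) v := by
    intro n
    induction n with
    | zero =>
      intro j hj
      obtain ⟨D, hD⟩ := G.jacMk_surjective x
      refine ⟨D, hD, fun v _ h => ?_⟩
      have := hj v
      omega
    | succ n ih =>
      intro j hj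
      obtain ⟨D, hD, hpos⟩ := ih (j + 1) (fun v => by have := hj v; omega)
      set S : Finset G.V := Finset.univ.filter fun u => f u < j
      have hS : (∑ u ∈ S, G.prin u) ∈ G.Div0 :=
        sum_mem fun u _ => G.prin_mem_Div0 hloop u
      have hS' : (∑ u ∈ S, G.prin u) ∈ G.Prin :=
        sum_mem fun u _ => AddSubgroup.subset_closure ⟨u, rfl⟩
      set m : ℕ := ∑ v, ((D : G.V → ℤ) v).natAbs
      refine ⟨D + m • ⟨_, hS⟩, ?_, fun v hv hjv => ?_⟩
      · rw [map_add, map_nsmul, G.jacMk_eq_zero (D := ⟨_, hS⟩) hS', hD]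
        simp
      · have hvS : v ∉ S := by simp [S, hjv]
        have happ : ((D + m • ⟨_, hS⟩ : G.Div0) : G.V → ℤ) v =
            (D : G.V → ℤ) v + m * (∑ u ∈ S, G.prin u) v := by
          simp
        rw [happ]
        rcases hjv.eq_or_lt with h | h
        · obtain ⟨d, -, hdv, hlt⟩ := hf v hv
          have h1 := G.sum_prin_apply_pos S hvS d hdv (by simp [S]; omega)
          have h2 : ((D : G.V → ℤ) v).natAbs ≤ m :=
            Finset.single_le_sum (f := fun v => ((D : G.V → ℤ) v).natAbs)
              (fun _ _ => Nat.zero_le _) (Finset.mem_univ v)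
          have h3 : (m : ℤ) ≤ m * (∑ u ∈ S, G.prin u) v :=
            le_mul_of_one_le_right (by positivity) h1
          omega
        · have h1 := G.sum_prin_apply_nonneg S hvS
          have h2 := hpos v hv h
          positivity
  obtain ⟨D, hD, h⟩ := key (∑ v, f v + 1) 0 fun v => by
    have := Finset.single_le_sum (f := f) (fun _ _ => Nat.zero_le _) (Finset.mem_univ v)
    omega
  exact ⟨D, hD, fun v hv => h v hv (Nat.zero_le _)⟩

end Multigraph

namespace RibbonGraph

variable (G : RibbonGraph)

/-! ### Angles between darts -/

lemma tail_iterate_next (d : G.D) (i : ℕ) : G.tail ((⇑G.next)^[i] d) = G.tail d := by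
  induction i with
  | zero => rfl
  | succ i ih => rw [Function.iterate_succ_apply', G.next_tail, ih]

lemma exists_iterate_next {d d' : G.D} (h : G.tail d = G.tail d') :
    ∃ i < Function.minimalPeriod G.next d, (⇑G.next)^[i + 1] d = d' := by
  have hp : 0 < Function.minimalPeriod G.next d :=
    Function.minimalPeriod_pos_of_mem_periodicPts
      (G.next.injective.mem_periodicPts d)
  obtain ⟨j, hj⟩ := (G.next_cyclic (G.next d) d' (by rw [G.next_tail, h])).exists_nat_pow_eq
  have hj' : (⇑G.next)^[j + 1] d = d' := by
    rw [Function.iterate_succ_apply, Equiv.Perm.iterate_eq_pow, hj]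
  refine ⟨j % Function.minimalPeriod G.next d, Nat.mod_lt _ hp, ?_⟩
  rw [Function.iterate_succ_apply', Function.iterate_mod_minimalPeriod_eq,
    ← Function.iterate_succ_apply' (⇑G.next), hj']

lemma sum_minimalPeriod {M : Type*} [AddCommMonoid M] (F : G.D → M) (d : G.D) :
    ∑ i ∈ Finset.range (Function.minimalPeriod G.next d), F ((⇑G.next)^[i + 1] d) =
      ∑ e ∈ Finset.univ.filter (fun e : G.D => G.tail e = G.tail d), F e := by
  refine Finset.sum_bij (fun i _ => (⇑G.next)^[i + 1] d) ?_ ?_ ?_ ?_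
  · intro i _
    simp only [Finset.mem_filter, Finset.mem_univ, true_and]
    exact G.tail_iterate_next d _
  · intro i hi j hj hij
    rw [Function.iterate_succ_apply', Function.iterate_succ_apply'] at hij
    exact Function.iterate_injOn_Iio_minimalPeriod (by simpa using hi) (by simpa using hj)
      (G.next.injective hij)
  · intro e he
    obtain ⟨i, hi, h⟩ := G.exists_iterate_next (Finset.mem_filter.1 he).2.symm
    exact ⟨i, Finset.mem_range.2 hi, h⟩
  · intro i _
    rfl

lemma sum_boundary_of_isPeriodicPt (hloop : G.Loopless) (d : G.D) (m : ℕ)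
    (h : (⇑G.next)^[m] d = d) :
    ∑ i ∈ Finset.range m, G.dartBoundary ((⇑G.next)^[i + 1] d) = 0 := by
  obtain ⟨k, rfl⟩ := Function.IsPeriodicPt.minimalPeriod_dvd (f := ⇑G.next) (x := d) h
  clear h
  induction k with
  | zero => simp
  | succ k ih =>
    rw [Nat.mul_succ, Finset.sum_range_add, ih, zero_add,
      ← G.sum_dartBoundary_tail hloop (G.tail d), ← G.sum_minimalPeriod]
    refine Finset.sum_congr rfl fun i _ => ?_
    congr 1
    rw [show Function.minimalPeriod G.next d * k + i + 1 =
      (i + 1) + Function.minimalPeriod G.next d * k by ring, Function.iterate_add_apply]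
    congr 1
    exact (Function.isPeriodicPt_minimalPeriod G.next d).mul_const k

lemma dartAngle_eq_sum (hloop : G.Loopless) (d : G.D) (k : ℕ) :
    G.dartAngle d ((⇑G.next)^[k] d) =
      ∑ i ∈ Finset.range k, G.dartBoundary ((⇑G.next)^[i + 1] d) := by
  have h : ∃ n : ℕ, (⇑G.next)^[n] d = (⇑G.next)^[k] d := ⟨k, rfl⟩
  rw [dartAngle, dif_pos h]
  obtain ⟨m, hm⟩ := Nat.exists_eq_add_of_le (Nat.find_min' h rfl)
  have hn := Nat.find_spec h
  set n := Nat.find h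
  have hper : (⇑G.next)^[m] ((⇑G.next)^[n] d) = (⇑G.next)^[n] d := by
    rw [← Function.iterate_add_apply, add_comm, ← hm, hn]
  have hzero := G.sum_boundary_of_isPeriodicPt hloop _ m hper
  rw [hm, Finset.sum_range_add]
  simp only [← Function.iterate_add_apply] at hzero
  simp only [show ∀ i, n + i + 1 = i + 1 + n by intro i; ring, hzero, add_zero]

/-! ### Rotor configurations oriented towards the root -/

/-- Following the rotors of `ρ` one step. -/
def RotorStep (q : G.V) (ρ : G.RotorConfig q) (a b : G.V) : Prop :=
  ∃ ha : a ≠ q, G.head (ρ.1 a ha) = b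

lemma not_reaches_of_invariant {q : G.V} {ρ : G.RotorConfig q} {P : G.V → Prop}
    (hP : ∀ a b, P a → G.RotorStep q ρ a b → P b) (hq : ¬ P q) {v : G.V} (hv : P v) :
    ¬ Relation.ReflTransGen (G.RotorStep q ρ) v q := by
  have hreach : ∀ x, Relation.ReflTransGen (G.RotorStep q ρ) v x → P x := by
    intro x h
    induction h with
    | refl => exact hv
    | tail _ h ih => exact hP _ _ ih h
  exact fun h => hq (hreach q h)

lemma rotor_ne_rev {q : G.V} {ρ : G.RotorConfig q}
    (hρ : ∀ v, Relation.ReflTransGen (G.RotorStep q ρ) v q)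
    {v w : G.V} (hv : v ≠ q) (hw : w ≠ q) : ρ.1 v hv ≠ G.rev (ρ.1 w hw) := by
  intro h
  refine G.not_reaches_of_invariant (P := fun a => a = v ∨ a = w) ?_ ?_ (Or.inl rfl) (hρ v)
  · rintro a b (rfl | rfl) ⟨ha, rfl⟩
    · right
      rw [h, G.head_rev, ρ.2]
    · left
      rw [← G.tail_rev, ← h, ρ.2]
  · rintro (h | h)
    · exact hv h.symm
    · exact hw h.symm

/-- The darts of the edges occupied by the rotors of `ρ`. -/
def rotorEdges (q : G.V) (ρ : G.RotorConfig q) : Finset G.D :=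
  Finset.univ.image (fun v : {v : G.V // v ≠ q} => ρ.1 v.1 v.2) ∪
    Finset.univ.image (fun v : {v : G.V // v ≠ q} => G.rev (ρ.1 v.1 v.2))

lemma mem_rotorEdges {q : G.V} {ρ : G.RotorConfig q} {d : G.D} :
    d ∈ G.rotorEdges q ρ ↔ ∃ v, ∃ hv : v ≠ q, ρ.1 v hv = d ∨ G.rev (ρ.1 v hv) = d := by
  simp only [rotorEdges, Finset.mem_union, Finset.mem_image, Finset.mem_univ, true_and,
    Subtype.exists, ← exists_or]

lemma card_rotorEdges {q : G.V} {ρ : G.RotorConfig q}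
    (hρ : ∀ v, Relation.ReflTransGen (G.RotorStep q ρ) v q) :
    (G.rotorEdges q ρ).card = 2 * (Fintype.card G.V - 1) := by
  have hinj : Function.Injective (fun v : {v : G.V // v ≠ q} => ρ.1 v.1 v.2) := by
    intro v w h
    have := congrArg G.tail h
    simp only [ρ.2] at this
    exact Subtype.ext this
  have hcard : Fintype.card {v : G.V // v ≠ q} = Fintype.card G.V - 1 := by
    simp [Fintype.card_subtype_compl]
  rw [rotorEdges, Finset.card_union_of_disjoint, Finset.card_image_of_injective _ hinj,
    Finset.card_image_of_injective (f := fun v : {v : G.V // v ≠ q} => G.rev (ρ.1 v.1 v.2)) _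
      (G.rev_invol.injective.comp hinj), Finset.card_univ, hcard, two_mul]
  rw [Finset.disjoint_left]
  simp only [Finset.mem_image, Finset.mem_univ, true_and]
  rintro _ ⟨v, rfl⟩ ⟨w, hw⟩
  exact G.rotor_ne_rev hρ v.2 w.2 hw.symm

lemma towardRoot_rotorEdges {q : G.V} {ρ : G.RotorConfig q}
    (hρ : ∀ v, Relation.ReflTransGen (G.RotorStep q ρ) v q) :
    G.TowardRoot q (G.rotorEdges q ρ) ρ :=
  fun v hv => ⟨G.mem_rotorEdges.2 ⟨v, hv, Or.inl rfl⟩, hρ v⟩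

lemma isSpanningTree_rotorEdges {q : G.V} {ρ : G.RotorConfig q}
    (hρ : ∀ v, Relation.ReflTransGen (G.RotorStep q ρ) v q) :
    G.IsSpanningTree (G.rotorEdges q ρ) := by
  have hrev : ∀ d ∈ G.rotorEdges q ρ, G.rev d ∈ G.rotorEdges q ρ := by
    intro d hd
    obtain ⟨v, hv, rfl | rfl⟩ := G.mem_rotorEdges.1 hd
    · exact G.mem_rotorEdges.2 ⟨v, hv, Or.inr rfl⟩
    · exact G.mem_rotorEdges.2 ⟨v, hv, Or.inl (G.rev_invol _).symm⟩
  have hto : ∀ u, Relation.ReflTransGen (G.treeAdj (G.rotorEdges q ρ)) u q := fun u =>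
    Relation.ReflTransGen.mono (r := G.RotorStep q ρ) (fun a _ ⟨ha, hb⟩ =>
      ⟨ρ.1 a ha, G.mem_rotorEdges.2 ⟨a, ha, Or.inl rfl⟩, ρ.2 a ha, hb⟩) _ _ (hρ u)
  have hsymm : ∀ a b, G.treeAdj (G.rotorEdges q ρ) a b → G.treeAdj (G.rotorEdges q ρ) b a := by
    rintro a b ⟨d, hd, ha, hb⟩
    exact ⟨G.rev d, hrev d hd, by rw [G.tail_rev, hb], by rw [G.head_rev, ha]⟩
  refine ⟨hrev, fun u v => (hto u).trans ?_, G.card_rotorEdges hρ⟩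
  exact Relation.ReflTransGen.mono (fun a b hab => hsymm b a hab) _ _ (hto v).swap

lemma TowardRoot.reaches {G : RibbonGraph} {q : G.V} {T : Finset G.D} {ρ : G.RotorConfig q}
    (h : G.TowardRoot q T ρ) (v : G.V) : Relation.ReflTransGen (G.RotorStep q ρ) v q := by
  by_cases hv : v = q
  · rw [hv]
  · exact (h v hv).2

lemma TowardRoot.eq_rotorEdges {G : RibbonGraph} {q : G.V} {T : Finset G.D}
    {ρ : G.RotorConfig q} (hT : G.IsSpanningTree T) (h : G.TowardRoot q T ρ) :
    G.rotorEdges q ρ = T := by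
  refine Finset.eq_of_subset_of_card_le ?_ ?_
  · intro d hd
    obtain ⟨v, hv, rfl | rfl⟩ := G.mem_rotorEdges.1 hd
    · exact (h v hv).1
    · exact hT.1 _ (h v hv).1
  · rw [hT.2.2, G.card_rotorEdges h.reaches]

lemma TowardRoot.unique {G : RibbonGraph} {q : G.V} {T : Finset G.D} {ρ ρ' : G.RotorConfig q}
    (hT : G.IsSpanningTree T) (h : G.TowardRoot q T ρ) (h' : G.TowardRoot q T ρ') :
    ρ = ρ' := by
  refine Subtype.ext (funext fun v => funext fun hv => ?_)
  by_contra hne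
  refine G.not_reaches_of_invariant (P := fun a => ∃ ha : a ≠ q, ρ.1 a ha ≠ ρ'.1 a ha)
    ?_ ?_ ⟨hv, hne⟩ (h'.reaches v)
  · rintro a b ⟨ha, hab⟩ ⟨_, rfl⟩
    have hmem := (h' a ha).1
    rw [← h.eq_rotorEdges hT] at hmem
    obtain ⟨w, hw, hd | hd⟩ := G.mem_rotorEdges.1 hmem
    · have := congrArg G.tail hd
      rw [ρ.2, ρ'.2] at this
      subst this
      exact absurd hd hab
    · have hhead : G.head (ρ'.1 a ha) = w := by rw [← hd, G.head_rev, ρ.2]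
      rw [hhead]
      refine ⟨hw, fun heq => ?_⟩
      rw [heq] at hd
      exact G.rotor_ne_rev h'.reaches ha hw hd.symm
  · rintro ⟨hq, -⟩
    exact hq rfl

lemma exists_towardRoot {T : Finset G.D} (hT : G.IsSpanningTree T) (q : G.V) :
    ∃ ρ : G.RotorConfig q, G.TowardRoot q T ρ := by
  obtain ⟨f, hf⟩ := G.exists_rank q T hT.2.1
  choose g hgT hgt hgf using hf
  refine ⟨⟨g, hgt⟩, fun v hv => ⟨hgT v hv, ?_⟩⟩
  clear hv
  induction hn : f v using Nat.strong_induction_on generalizing v with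
  | _ n ih =>
    by_cases hv : v = q
    · rw [hv]
    · exact Relation.ReflTransGen.head ⟨hv, rfl⟩ (ih _ (hn ▸ hgf v hv) _ rfl)

lemma treeAngle_eq {q : G.V} {T T' : Finset G.D} (hT : G.IsSpanningTree T)
    (hT' : G.IsSpanningTree T') {ρ ρ' : G.RotorConfig q}
    (h : G.TowardRoot q T ρ) (h' : G.TowardRoot q T' ρ') :
    G.treeAngle q T T' =
      ∑ u : G.V, if hu : u = q then 0 else G.dartAngle (ρ.1 u hu) (ρ'.1 u hu) := by
  have hex : ∃ p : G.RotorConfig q × G.RotorConfig q,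
      G.TowardRoot q T p.1 ∧ G.TowardRoot q T' p.2 := ⟨(ρ, ρ'), h, h'⟩
  rw [treeAngle, dif_pos hex]
  rw [hex.choose_spec.1.unique hT h, hex.choose_spec.2.unique hT' h']

/-! ### Firing counts -/

/-- The state `s'` is obtained from `s` by firing each vertex `u` exactly `k u` times. -/
def FiresTo (q : G.V) (s s' : (G.V → ℤ) × G.RotorConfig q) (k : G.V → ℕ) : Prop :=
  k q = 0 ∧ (∀ u (hu : u ≠ q), s'.2.1 u hu = (⇑G.next)^[k u] (s.2.1 u hu)) ∧
    s'.1 = s.1 + ((∑ u : G.V, if hu : u = q then 0 else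
      ∑ i ∈ Finset.range (k u), G.dartDiv ((⇑G.next)^[i + 1] (s.2.1 u hu)) : G.Div0) : G.V → ℤ)

lemma firesTo_refl (q : G.V) (s : (G.V → ℤ) × G.RotorConfig q) : G.FiresTo q s s 0 := by
  refine ⟨rfl, fun _ _ => rfl, ?_⟩
  simp

variable {G}

lemma FiresTo.fire {q : G.V} {s s' : (G.V → ℤ) × G.RotorConfig q} {k : G.V → ℕ}
    (h : G.FiresTo q s s' k) {v : G.V} (hv : v ≠ q) :
    G.FiresTo q s (G.fire q v hv s') (k + Pi.single v 1) := by
  obtain ⟨h0, hρ, hc⟩ := h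
  refine ⟨by simp [h0, Ne.symm hv], fun u hu => ?_, ?_⟩
  · by_cases huv : u = v
    · subst huv
      simp [RibbonGraph.fire, hρ, Function.iterate_succ_apply']
    · simp [RibbonGraph.fire, hρ, huv]
  · have hsum : (∑ u : G.V, if hu : u = q then (0 : G.Div0) else
        ∑ i ∈ Finset.range ((k + Pi.single v 1 : G.V → ℕ) u),
          G.dartDiv ((⇑G.next)^[i + 1] (s.2.1 u hu))) =
        (∑ u : G.V, if hu : u = q then (0 : G.Div0) else
        ∑ i ∈ Finset.range (k u), G.dartDiv ((⇑G.next)^[i + 1] (s.2.1 u hu))) +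
          G.dartDiv (G.next (s'.2.1 v hv)) := by
      rw [hρ, ← Finset.add_sum_erase _ _ (Finset.mem_univ v),
        ← Finset.add_sum_erase _ _ (Finset.mem_univ v), dif_neg hv, dif_neg hv, Pi.add_apply,
        Pi.single_eq_same, Finset.sum_range_succ, Function.iterate_succ_apply', add_right_comm]
      congr 2
      refine Finset.sum_congr rfl fun u hu => ?_
      simp [Finset.ne_of_mem_erase hu]
    rw [hsum, AddSubgroup.coe_add, ← add_assoc, ← hc]
    funext w
    simp only [RibbonGraph.fire, Pi.add_apply, G.dartDiv_apply, G.next_tail, s'.2.2]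
    ring

lemma exists_firesTo {q : G.V} {s s' : (G.V → ℤ) × G.RotorConfig q}
    (h : Relation.ReflTransGen (G.Step q) s s') : ∃ k, G.FiresTo q s s' k := by
  induction h with
  | refl => exact ⟨0, G.firesTo_refl q s⟩
  | tail _ h ih =>
    obtain ⟨k, hk⟩ := ih
    obtain ⟨v, hv, -, rfl⟩ := h
    exact ⟨_, hk.fire hv⟩

/-- A state can only return to itself if no vertex is fired. -/
lemma FiresTo.eq_zero (hconn : G.Connected) {q : G.V} {s : (G.V → ℤ) × G.RotorConfig q}
    {k : G.V → ℕ} (h : G.FiresTo q s s k) : k = 0 := by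
  obtain ⟨h0, hρ, hc⟩ := h
  have hbal : ∀ w, (∑ u : G.V, if hu : u = q then (0 : ℤ) else
      ∑ i ∈ Finset.range (k u),
        if w = G.head ((⇑G.next)^[i + 1] (s.2.1 u hu)) then 1 else 0) = k w := by
    intro w
    have h1 := congrFun (left_eq_add.1 hc) w
    rw [AddSubgroup.val_finsetSum, Finset.sum_apply] at h1
    have h2 : ∀ u : G.V, ((if hu : u = q then (0 : G.Div0) else
        ∑ i ∈ Finset.range (k u), G.dartDiv ((⇑G.next)^[i + 1] (s.2.1 u hu)) : G.Div0) :
          G.V → ℤ) w = (if hu : u = q then (0 : ℤ) else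
      ∑ i ∈ Finset.range (k u),
        if w = G.head ((⇑G.next)^[i + 1] (s.2.1 u hu)) then 1 else 0) -
          if w = u then (k u : ℤ) else 0 := by
      intro u
      split_ifs with hu hw hw
      · subst hu
        simp [h0]
      · simp
      all_goals
        rw [AddSubgroup.val_finsetSum, Finset.sum_apply]
        simp only [G.dartDiv_apply, G.tail_iterate_next, s.2.2, hw, if_true, if_false,
          Finset.sum_sub_distrib]
        simp
    simp only [h2, Finset.sum_sub_distrib, Pi.zero_apply] at h1
    simpa [sub_eq_zero] using h1
  have hstep : ∀ a b, G.Adj a b → k a ≠ 0 → k b ≠ 0 := by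
    rintro _ b ⟨d, rfl, rfl⟩ ha
    have haq : G.tail d ≠ q := fun h => ha (h ▸ h0)
    obtain ⟨i, hi, hid⟩ := G.exists_iterate_next (s.2.2 _ haq)
    have hle : Function.minimalPeriod G.next (s.2.1 _ haq) ≤ k (G.tail d) :=
      Function.IsPeriodicPt.minimalPeriod_le (Nat.pos_of_ne_zero ha) (hρ _ haq).symm
    have hpos : (0 : ℤ) < k (G.head d) := by
      rw [← hbal]
      refine Finset.sum_pos' (fun u _ => ?_) ⟨G.tail d, Finset.mem_univ _, ?_⟩
      · split_ifs
        · rfl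
        · exact Finset.sum_nonneg fun _ _ => by split_ifs <;> simp
      · rw [dif_neg haq]
        refine Finset.sum_pos' (fun _ _ => by split_ifs <;> simp)
          ⟨i, Finset.mem_range.2 (hi.trans_le hle), ?_⟩
        rw [hid, if_pos rfl]
        exact one_pos
    omega
  funext a
  by_contra ha
  have hreach : ∀ b, Relation.ReflTransGen G.Adj a b → k b ≠ 0 := by
    intro b h
    induction h with
    | refl => exact ha
    | tail _ h ih => exact hstep _ _ h ih
  exact hreach q (hconn a q) h0

lemma not_transGen_step_self (hconn : G.Connected) {q : G.V}
    (s : (G.V → ℤ) × G.RotorConfig q) : ¬ Relation.TransGen (G.Step q) s s := by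
  intro h
  obtain ⟨s', h1, v, hv, -, h2⟩ := Relation.TransGen.tail'_iff.1 h
  obtain ⟨k, hk⟩ := exists_firesTo h1
  have hk' := hk.fire hv
  rw [← h2] at hk'
  have := congrFun (hk'.eq_zero hconn) v
  simp at this

/-! ### Invariants and termination of the rotor-routing process -/

/-- The chip count is nonnegative away from `q`, and the rotors lead from every vertex
to `q` or to a vertex carrying a chip. -/
def Balanced (q : G.V) (s : (G.V → ℤ) × G.RotorConfig q) : Prop :=
  (∀ v, v ≠ q → 0 ≤ s.1 v) ∧
    ∀ u, ∃ y, (y = q ∨ 1 ≤ s.1 y) ∧ Relation.ReflTransGen (G.RotorStep q s.2) u y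

lemma Balanced.step {q : G.V} {s s' : (G.V → ℤ) × G.RotorConfig q}
    (hs : Balanced q s) (h : G.Step q s s') : Balanced q s' := by
  obtain ⟨v, hv, hchip, rfl⟩ := h
  obtain ⟨hpos, hlead⟩ := hs
  set w := G.head (G.next (s.2.1 v hv)) with hw
  have hc : ∀ x, (G.fire q v hv s).1 x =
      s.1 x - (if x = v then 1 else 0) + (if x = w then 1 else 0) := fun _ => rfl
  have hstepv : G.RotorStep q (G.fire q v hv s).2 v w := ⟨hv, by simp [RibbonGraph.fire, hw]⟩
  have hstep : ∀ a b, a ≠ v → G.RotorStep q s.2 a b →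
      G.RotorStep q (G.fire q v hv s).2 a b := by
    rintro a b hav ⟨ha, rfl⟩
    exact ⟨ha, by simp [RibbonGraph.fire, hav]⟩
  have htarget : w = q ∨ 1 ≤ (G.fire q v hv s).1 w := by
    by_cases hwq : w = q
    · exact Or.inl hwq
    · right
      rw [hc, if_pos rfl]
      have := hpos w hwq
      split_ifs with hwv
      · rw [hwv]; omega
      · omega
  refine ⟨fun x hx => ?_, fun u => ?_⟩
  · rw [hc]
    have := hpos x hx
    split_ifs with h1 h2 h2 <;> first | omega | (rw [h1]; omega)
  · obtain ⟨y, hy, huy⟩ := hlead u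
    induction huy using Relation.ReflTransGen.head_induction_on with
    | refl =>
      by_cases hyv : y = v
      · subst hyv
        exact ⟨w, htarget, .single hstepv⟩
      · refine ⟨y, hy.imp id fun h => ?_, .refl⟩
        rw [hc, if_neg hyv]
        split_ifs <;> omega
    | @head a b hab _ ih =>
      by_cases hav : a = v
      · subst hav
        exact ⟨w, htarget, .single hstepv⟩
      · obtain ⟨z, hz, hbz⟩ := ih
        exact ⟨z, hz, hbz.head (hstep a b hav hab)⟩

lemma Balanced.reflTransGen {q : G.V} {s s' : (G.V → ℤ) × G.RotorConfig q}
    (hs : Balanced q s) (h : Relation.ReflTransGen (G.Step q) s s') : Balanced q s' := by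
  induction h with
  | refl => exact hs
  | tail _ h ih => exact ih.step h

lemma reflTransGen_step_apply_root {q : G.V} {s s' : (G.V → ℤ) × G.RotorConfig q}
    (h : Relation.ReflTransGen (G.Step q) s s') : s.1 q ≤ s'.1 q := by
  induction h with
  | refl => exact le_rfl
  | tail _ h ih =>
    obtain ⟨v, hv, -, rfl⟩ := h
    refine ih.trans ?_
    simp only [RibbonGraph.fire, if_neg (Ne.symm hv)]
    split_ifs <;> omega

lemma reflTransGen_step_mem_Div0 {q : G.V} {s s' : (G.V → ℤ) × G.RotorConfig q}
    (hs : s.1 ∈ G.Div0) (h : Relation.ReflTransGen (G.Step q) s s') : s'.1 ∈ G.Div0 := by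
  obtain ⟨k, -, -, hk⟩ := exists_firesTo h
  rw [hk]
  exact add_mem hs (Subtype.coe_prop _)

instance (q : G.V) : Finite (G.RotorConfig q) := Subtype.finite

lemma finite_reachable {q : G.V} {s : (G.V → ℤ) × G.RotorConfig q}
    (hs : s.1 ∈ G.Div0) (hb : Balanced q s) :
    {s' | Relation.ReflTransGen (G.Step q) s s'}.Finite := by
  refine Set.Finite.subset
    ((Set.finite_Icc (fun _ : G.V => s.1 q) (fun _ => -s.1 q)).prod
      (Set.finite_univ (α := G.RotorConfig q))) ?_
  intro s' h
  have hpos := (hb.reflTransGen h).1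
  have hroot := reflTransGen_step_apply_root h
  have hsum : s'.1 q + ∑ v ∈ Finset.univ.erase q, s'.1 v = 0 := by
    rw [Finset.add_sum_erase _ _ (Finset.mem_univ q)]
    exact reflTransGen_step_mem_Div0 hs h
  have hnonneg : ∀ v ∈ Finset.univ.erase q, 0 ≤ s'.1 v :=
    fun v hv => hpos v (Finset.ne_of_mem_erase hv)
  have htot := Finset.sum_nonneg hnonneg
  have hbound : ∀ v, s.1 q ≤ s'.1 v ∧ s'.1 v ≤ -s.1 q := by
    intro v
    by_cases hv : v = q
    · subst hv
      omega
    · have h1 := hpos v hv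
      have h2 := Finset.single_le_sum hnonneg (Finset.mem_erase.2 ⟨hv, Finset.mem_univ v⟩)
      omega
  exact ⟨⟨fun v => (hbound v).1, fun v => (hbound v).2⟩, trivial⟩

lemma exists_terminal (hconn : G.Connected) {q : G.V} {s : (G.V → ℤ) × G.RotorConfig q}
    (hs : s.1 ∈ G.Div0) (hb : Balanced q s) :
    ∃ s', Relation.ReflTransGen (G.Step q) s s' ∧ G.Terminal q s' := by
  let r : (G.V → ℤ) × G.RotorConfig q → (G.V → ℤ) × G.RotorConfig q → Prop :=
    fun a b => Relation.TransGen (G.Step q) b a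
  have : IsStrictOrder _ r :=
    { irrefl := fun a => not_transGen_step_self hconn a
      trans := fun a b c hab hbc => Relation.TransGen.trans hbc hab }
  have hwf : {s' | Relation.ReflTransGen (G.Step q) s s'}.WellFoundedOn r :=
    (finite_reachable hs hb).wellFoundedOn
  obtain ⟨⟨s', hs'⟩, -, hmin⟩ := WellFounded.has_min hwf Set.univ
    ⟨⟨s, Relation.ReflTransGen.refl⟩, trivial⟩
  refine ⟨s', hs', fun v hv => ?_⟩
  by_contra hchip
  have hstep : G.Step q s' (G.fire q v hv s') := ⟨v, hv, by omega, rfl⟩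
  exact hmin ⟨_, Relation.ReflTransGen.tail hs' hstep⟩ trivial (Relation.TransGen.single hstep)

variable (G) in
lemma exists_actsTo (hconn : G.Connected) (hloop : G.Loopless) (q : G.V) {T : Finset G.D}
    (hT : G.IsSpanningTree T) (x : G.Jac) :
    ∃ T' : Finset G.D, G.IsSpanningTree T' ∧ G.ActsTo q x T T' := by
  obtain ⟨D, hD, hpos⟩ := G.exists_nonneg_representative hloop q T hT.2.1 x
  obtain ⟨ρ, hρ⟩ := G.exists_towardRoot hT q
  have hb : Balanced q ((D : G.V → ℤ), ρ) :=
    ⟨hpos, fun u => ⟨q, Or.inl rfl, hρ.reaches u⟩⟩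
  obtain ⟨⟨c', ρ'⟩, hreach, hterm⟩ := exists_terminal hconn (Subtype.coe_prop D) hb
  have hlead : ∀ u, Relation.ReflTransGen (G.RotorStep q ρ') u q := by
    intro u
    obtain ⟨y, hy, huy⟩ := (hb.reflTransGen hreach).2 u
    by_cases hyq : y = q
    · exact hyq ▸ huy
    · have h1 := hterm y hyq
      have h2 := hy.resolve_left hyq
      omega
  exact ⟨_, G.isSpanningTree_rotorEdges hlead, D, hD, hpos, ρ, ρ', c', hρ,
    G.towardRoot_rotorEdges hlead, hreach, hterm⟩

lemma ActsTo.treeAngle_eq_neg (hloop : G.Loopless) {q : G.V} {T T' : Finset G.D}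
    (hT : G.IsSpanningTree T) (hT' : G.IsSpanningTree T') {x : G.Jac}
    (h : G.ActsTo q x T T') : G.treeAngle q T T' = -x := by
  obtain ⟨D, rfl, hpos, ρ, ρ', c', hρ, hρ', hreach, hterm⟩ := h
  have hb : Balanced q ((D : G.V → ℤ), ρ) :=
    ⟨hpos, fun u => ⟨q, Or.inl rfl, hρ.reaches u⟩⟩
  have hoff : ∀ v, v ≠ q → c' v = 0 := fun v hv =>
    le_antisymm (hterm v hv) ((hb.reflTransGen hreach).1 v hv)
  have hsum : ∑ v, c' v = 0 := reflTransGen_step_mem_Div0 (Subtype.coe_prop D) hreach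
  rw [Finset.sum_eq_single q (fun v _ hv => hoff v hv) (by simp)] at hsum
  have hzero : c' = 0 := by
    funext v
    by_cases hv : v = q
    · rw [hv, hsum, Pi.zero_apply]
    · exact hoff v hv
  obtain ⟨k, -, hk, hc⟩ := exists_firesTo hreach
  simp only [hzero] at hc
  have hdiv : D + (∑ u : G.V, if hu : u = q then 0 else
      ∑ i ∈ Finset.range (k u), G.dartDiv ((⇑G.next)^[i + 1] (ρ.1 u hu))) = 0 :=
    Subtype.ext hc.symm
  rw [G.treeAngle_eq hT hT' hρ hρ']
  refine eq_neg_of_add_eq_zero_right ?_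
  have hmap := congrArg G.jacMk hdiv
  rw [map_add, map_zero, map_sum] at hmap
  refine Eq.trans ?_ hmap
  refine congrArg₂ (· + ·) rfl (Finset.sum_congr rfl fun u _ => ?_)
  split_ifs with hu
  · rw [map_zero]
  · rw [hk u hu, G.dartAngle_eq_sum hloop, map_sum]
    rfl

end RibbonGraph

/-- For any ribbon graph `G`, spanning tree `T`, vertex `v`, and
`[D] ∈ Jac(G)`, the angle based at `v` between `T` and `[D]·T` (rotor-routing
with basepoint `v`) is `[-D]`. -/
theorem angle_of_rotor_action (G : RibbonGraph)
    (hconn : G.Connected) (hloop : G.Loopless)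
    (v : G.V) (T : Finset G.D) (hT : G.IsSpanningTree T) (x : G.Jac) :
    G.treeAngle v T (G.rotorAction v x T) = -x := by
  have h := G.exists_actsTo hconn hloop v hT x
  rw [RibbonGraph.rotorAction, dif_pos h]
  exact h.choose_spec.2.treeAngle_eq_neg hloop hT h.choose_spec.1
end

section
/- Let G be a planar ribbon graph embedded in the plane such that G and its planar dual G* are both loopless, with dual edge orientations as specified. Then the map ℤE → ℤE* sending each oriented edge e to its oriented dual edge e* carries the integral cycle space of G onto the integral cut space of G* and the integral cut space of G onto the integral cycle space of G*, and hence induces a group isomorphism ℰ(G) ≅ ℰ(G*), where ℰ(H) = ℤE(H)/(𝒞(H) + 𝒞*(H)). -/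
attribute [local instance 10] Classical.propDecidable

namespace Multigraph

variable (H : Multigraph)

/-! ### Cuts as coboundaries -/

lemma cutVec_apply (U : Finset H.V) (d : H.D) :
    H.cutVec U d = (if H.tail d ∈ U then 1 else 0) - (if H.head d ∈ U then 1 else 0) := by
  unfold cutVec
  by_cases h1 : H.tail d ∈ U <;> by_cases h2 : H.head d ∈ U <;> simp [h1, h2]

theorem mem_cutSpace_iff (x : H.D → ℤ) :
    x ∈ H.CutSpace ↔ ∃ f : H.V → ℤ, ∀ d, x d = f (H.tail d) - f (H.head d) := by
  constructor
  · intro hx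
    induction hx using AddSubgroup.closure_induction with
    | mem x hx =>
      obtain ⟨U, rfl⟩ := hx
      exact ⟨fun v => if v ∈ U then 1 else 0, H.cutVec_apply U⟩
    | zero => exact ⟨0, by simp⟩
    | add x y _ _ hx hy =>
      obtain ⟨f, hf⟩ := hx
      obtain ⟨g, hg⟩ := hy
      exact ⟨f + g, fun d => by simp only [Pi.add_apply, hf, hg]; ring⟩
    | neg x _ hx =>
      obtain ⟨f, hf⟩ := hx
      exact ⟨-f, fun d => by simp only [Pi.neg_apply, hf]; ring⟩
  · rintro ⟨f, hf⟩
    have hsum : x = ∑ v, f v • H.cutVec {v} := by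
      funext d
      simp [hf, cutVec_apply, Finset.sum_apply, mul_sub, Finset.sum_sub_distrib]
    rw [hsum]
    exact AddSubgroup.sum_mem _ fun v _ =>
      AddSubgroup.zsmul_mem _ (AddSubgroup.subset_closure (Set.mem_range_self {v})) _

/-! ### The cycle space as the kernel of the boundary map -/

lemma head_rev_s11 (d : H.D) : H.head (H.rev d) = H.tail d := rfl

lemma tail_rev_s11 (d : H.D) : H.tail (H.rev d) = H.head d := by
  rw [tail, H.rev_invol]

lemma dartVec_apply (d d' : H.D) :
    H.dartVec d d' = (if d' = d then 1 else 0) - (if d' = H.rev d then 1 else 0) := by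
  unfold dartVec
  rcases eq_or_ne d' d with rfl | h
  · simp [(H.rev_ne d').symm]
  · simp only [h, if_false]
    split_ifs <;> simp

lemma listVec_apply (l : List H.D) (d : H.D) :
    H.listVec l d = (l.count d : ℤ) - l.count (H.rev d) := by
  induction l with
  | nil => simp [listVec]
  | cons a l ih =>
    have hcons : H.listVec (a :: l) d = H.dartVec a d + H.listVec l d := by
      simp [listVec]
    have hrev : d = H.rev a ↔ a = H.rev d :=
      ⟨fun h => by rw [h, H.rev_invol], fun h => by rw [h, H.rev_invol]⟩
    rw [hcons, ih, dartVec_apply, List.count_cons, List.count_cons]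
    simp only [beq_iff_eq, hrev, eq_comm (a := d) (b := a)]
    push_cast
    ring

lemma listVec_mem (l : List H.D) : H.listVec l ∈ H.EdgeGroup := by
  refine H.EdgeGroup.list_sum_mem fun x hx => ?_
  obtain ⟨d, -, rfl⟩ := List.mem_map.1 hx
  exact H.dartVec_mem d

lemma bMap_apply (x : H.D → ℤ) (v : H.V) :
    H.bMap x v = ∑ d ∈ Finset.univ.filter (fun d => H.head d = v), x d := rfl

lemma bMap_dartVec (d : H.D) :
    H.bMap (H.dartVec d) = Pi.single (H.head d) 1 - Pi.single (H.tail d) 1 := by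
  funext v
  simp [bMap_apply, dartVec_apply, Finset.sum_sub_distrib, head_rev_s11, Pi.single_apply, eq_comm]

lemma sum_map_sub_of_isChain {A : Type*} [AddCommGroup A] (φ : H.V → A) (a : H.D)
    (l : List H.D) (hl : (a :: l).IsChain fun a b => H.head a = H.tail b) :
    ((a :: l).map fun d => φ (H.head d) - φ (H.tail d)).sum =
      φ (H.head ((a :: l).getLast (by simp))) - φ (H.tail a) := by
  induction l generalizing a with
  | nil => simp
  | cons b l ih =>
    rw [List.isChain_cons_cons] at hl
    rw [List.map_cons, List.sum_cons, ih b hl.2, List.getLast_cons (List.cons_ne_nil b l),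
      ← hl.1]
    abel

lemma bMap_listVec_eq_zero {l : List H.D} (hl : H.IsDirCycle l) : H.bMap (H.listVec l) = 0 := by
  obtain ⟨hne, hchain, hclosed, -⟩ := hl
  obtain ⟨a, l, rfl⟩ := List.exists_cons_of_ne_nil hne
  have hsum := H.sum_map_sub_of_isChain (fun v => (Pi.single v 1 : H.V → ℤ)) a l hchain
  rw [listVec, map_list_sum, List.map_map]
  have hcomp : (H.bMap ∘ H.dartVec) = fun d => Pi.single (H.head d) 1 - Pi.single (H.tail d) 1 :=
    funext H.bMap_dartVec
  rw [hcomp, hsum, hclosed _ (List.getLast?_eq_getLast_of_ne_nil hne) a (by simp), sub_self]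

/-- A circulation that is positive somewhere has a directed cycle in its positive support. -/
lemma exists_isDirCycle_pos {x : H.D → ℤ} (hx : x ∈ H.EdgeGroup) (hb : H.bMap x = 0)
    {d₀ : H.D} (hd₀ : 0 < x d₀) : ∃ l : List H.D, H.IsDirCycle l ∧ ∀ d ∈ l, 0 < x d := by
  have hstep : ∀ d : {d // 0 < x d}, ∃ d' : {d // 0 < x d}, H.tail d'.1 = H.head d.1 := by
    rintro ⟨d, hd⟩
    by_contra! hcon
    have hnonneg : ∀ e ∈ Finset.univ.filter (fun e => H.head e = H.head d), 0 ≤ x e := by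
      intro e he
      by_contra! hneg
      refine hcon ⟨H.rev e, ?_⟩ ?_
      · rw [hx e]
        omega
      · rw [tail_rev_s11]
        exact (Finset.mem_filter.1 he).2
    have hzero := congrFun hb (H.head d)
    rw [bMap_apply, Pi.zero_apply, Finset.sum_eq_zero_iff_of_nonneg hnonneg] at hzero
    have := hzero d (by simp)
    omega
  choose s hs using hstep
  let e : ℕ → {d // 0 < x d} := fun k => s^[k] ⟨d₀, hd₀⟩
  have he : ∀ k, H.head (e k).1 = H.tail (e (k + 1)).1 := fun k => by
    simp only [e, Function.iterate_succ_apply', hs]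
  have hex : ∃ n, 0 < n ∧ ∃ i, H.tail (e i).1 = H.tail (e (i + n)).1 := by
    obtain ⟨i, j, hij, h⟩ := Finite.exists_ne_map_eq_of_infinite fun k => H.tail (e k).1
    rcases lt_or_gt_of_ne hij with hlt | hlt
    · exact ⟨j - i, by omega, i, by rw [Nat.add_sub_cancel' hlt.le]; exact h⟩
    · exact ⟨i - j, by omega, j, by rw [Nat.add_sub_cancel' hlt.le]; exact h.symm⟩
  classical
  obtain ⟨hpos, i, hi⟩ := Nat.find_spec hex
  have hmin := fun m => @Nat.find_min _ _ hex m
  generalize Nat.find hex = n at *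
  have hdistinct : ∀ k l, k < l → l < n →
      H.tail (e (i + k)).1 ≠ H.tail (e (i + l)).1 := by
    intro k l hkl hln heq
    refine hmin (l - k) (by omega) ⟨by omega, i + k, ?_⟩
    rwa [show i + k + (l - k) = i + l by omega]
  refine ⟨(List.range n).map fun k => (e (i + k)).1, ⟨by simp; omega, ?_, ?_, ?_⟩, ?_⟩
  · change List.IsChain _ _
    rw [List.isChain_iff_getElem]
    intro k hk
    simp only [List.getElem_map, List.getElem_range]
    exact he _
  · obtain ⟨m, rfl⟩ : ∃ m, n = m + 1 := ⟨n - 1, by omega⟩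
    intro a ha b hb
    have ha' : a = (e (i + m)).1 := by
      simpa [List.range_succ, eq_comm] using ha
    have hb' : b = (e i).1 := by
      simpa [List.range_succ_eq_map, eq_comm] using hb
    rw [ha', hb', he, hi]
    rfl
  · rw [List.map_map]
    refine List.Nodup.map_on ?_ List.nodup_range
    intro k hk l hl hkl
    rw [List.mem_range] at hk hl
    rcases lt_trichotomy k l with h | h | h
    · exact absurd hkl (hdistinct k l h hl)
    · exact h
    · exact absurd hkl.symm (hdistinct l k h hk)
  · intro d hd
    obtain ⟨k, -, rfl⟩ := List.mem_map.1 hd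
    exact (e (i + k)).2

lemma abs_sub_listVec_lt {x : H.D → ℤ} (hx : x ∈ H.EdgeGroup) {l : List H.D}
    (hl : H.IsDirCycle l) (hpos : ∀ d ∈ l, 0 < x d) :
    ∑ d, |(x - H.listVec l) d| < ∑ d, |x d| := by
  have hnodup : l.Nodup := hl.2.2.2.of_map
  have hmem : ∀ d ∈ l, |(x - H.listVec l) d| < |x d| := by
    intro d hd
    have hrev : H.rev d ∉ l := fun h => by
      have h1 := hpos _ h
      have h2 := hpos _ hd
      rw [hx d] at h1
      omega
    have hxd := hpos d hd
    rw [Pi.sub_apply, listVec_apply, List.count_eq_one_of_mem hnodup hd,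
      List.count_eq_zero_of_not_mem hrev, abs_of_pos hxd, abs_of_nonneg] <;>
    · push_cast
      omega
  obtain ⟨a, ha⟩ := List.exists_mem_of_ne_nil l hl.1
  refine Finset.sum_lt_sum (fun d _ => ?_) ⟨a, Finset.mem_univ a, hmem a ha⟩
  by_cases hd : d ∈ l
  · exact (hmem d hd).le
  by_cases hrev : H.rev d ∈ l
  · have h := (hmem _ hrev).le
    rwa [(H.EdgeGroup.sub_mem hx (H.listVec_mem l)) d, hx d, abs_neg, abs_neg] at h
  · rw [Pi.sub_apply, listVec_apply, List.count_eq_zero_of_not_mem hd,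
      List.count_eq_zero_of_not_mem hrev]
    simp

theorem mem_cycleSpace_iff (x : H.D → ℤ) :
    x ∈ H.CycleSpace ↔ x ∈ H.EdgeGroup ∧ H.bMap x = 0 := by
  constructor
  · intro hx
    suffices H.CycleSpace ≤ H.EdgeGroup ⊓ H.bMap.ker from this hx
    rw [CycleSpace, AddSubgroup.closure_le]
    rintro _ ⟨l, hl, rfl⟩
    exact ⟨H.listVec_mem l, H.bMap_listVec_eq_zero hl⟩
  · rintro ⟨hx, hb⟩
    induction hn : (∑ d, |x d|).toNat using Nat.strong_induction_on generalizing x with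
    | _ n ih =>
      subst hn
      by_cases h0 : x = 0
      · rw [h0]
        exact H.CycleSpace.zero_mem
      obtain ⟨d, hd⟩ := Function.ne_iff.1 h0
      obtain ⟨d₀, hd₀⟩ : ∃ d₀, 0 < x d₀ := by
        rcases lt_or_gt_of_ne hd with h | h
        · exact ⟨H.rev d, by rw [hx d]; simpa using h⟩
        · exact ⟨d, h⟩
      obtain ⟨l, hl, hpos⟩ := H.exists_isDirCycle_pos hx hb hd₀
      have hlt := H.abs_sub_listVec_lt hx hl hpos
      have hnn : 0 ≤ ∑ d, |(x - H.listVec l) d| := Finset.sum_nonneg fun _ _ => abs_nonneg _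
      have hrest := ih _ (by omega) (x - H.listVec l) (H.EdgeGroup.sub_mem hx (H.listVec_mem l))
        (by rw [map_sub, hb, H.bMap_listVec_eq_zero hl, sub_self]) rfl
      have hcycle : H.listVec l ∈ H.CycleSpace := AddSubgroup.subset_closure ⟨l, hl, rfl⟩
      simpa using H.CycleSpace.add_mem hrest hcycle

end Multigraph

/-! ### Coboundaries over `ℚ` -/

section Coboundary

variable {D V F : Type*}

/-- The coboundary `f ↦ (d ↦ f (h (rev d)) - f (h d))` of a head map `h` with reversal `rev`. -/
def coboundary (rev : D → D) (h : D → V) : (V → ℚ) →ₗ[ℚ] (D → ℚ) :=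
  LinearMap.funLeft ℚ ℚ (h ∘ rev) - LinearMap.funLeft ℚ ℚ h

lemma coboundary_apply (rev : D → D) (h : D → V) (f : V → ℚ) (d : D) :
    coboundary rev h f d = f (h (rev d)) - f (h d) := rfl

/-- The functions that are antisymmetric under `rev`. -/
def antisymmetric (rev : D → D) : Submodule ℚ (D → ℚ) where
  carrier := {x | ∀ d, x (rev d) = -x d}
  add_mem' := by
    intro a b ha hb d
    simp only [Pi.add_apply, ha d, hb d]
    ring
  zero_mem' := by simp
  smul_mem' := by
    intro c x hx d
    simp [hx d]

lemma mem_antisymmetric {rev : D → D} {x : D → ℚ} :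
    x ∈ antisymmetric rev ↔ ∀ d, x (rev d) = -x d := Iff.rfl

lemma range_coboundary_le {rev : D → D} (hrev : Function.Involutive rev) (h : D → V) :
    LinearMap.range (coboundary rev h) ≤ antisymmetric rev := by
  rintro _ ⟨f, rfl⟩ d
  simp only [coboundary_apply, hrev d]
  ring

lemma finrank_antisymmetric_le [Fintype D] {rev : D → D} (hrev : Function.Involutive rev)
    (hne : ∀ d, rev d ≠ d) :
    Module.finrank ℚ (antisymmetric rev) ≤ Fintype.card D / 2 := by
  classical
  let r := Fintype.equivFin D
  let P : Finset D := Finset.univ.filter fun d => r d < r (rev d)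
  have hP : P.card = Pᶜ.card := by
    refine Finset.card_bij (fun d _ => rev d) ?_ (fun _ _ _ _ h => hrev.injective h) ?_
    · intro d hd
      have : r d < r (rev d) := (Finset.mem_filter.1 hd).2
      simp [P, hrev d, this.le]
    · intro d hd
      refine ⟨rev d, ?_, hrev d⟩
      have h1 : r (rev d) ≤ r d := by simpa [P] using hd
      have h2 : r (rev d) ≠ r d := fun h => hne d (r.injective h)
      simp [P, hrev d, lt_of_le_of_ne h1 h2]
  have hcard : P.card = Fintype.card D / 2 := by
    have := P.card_add_card_compl
    omega
  let ρ : antisymmetric rev →ₗ[ℚ] (P → ℚ) :=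
    (LinearMap.funLeft ℚ ℚ (Subtype.val : P → D)).comp (antisymmetric rev).subtype
  have hρ : Function.Injective ρ := by
    rw [injective_iff_map_eq_zero]
    rintro ⟨x, hx⟩ h
    have hval : ∀ d ∈ P, x d = 0 := fun d hd => congrFun h ⟨d, hd⟩
    ext d
    by_cases hd : d ∈ P
    · exact hval d hd
    · have h1 : r (rev d) ≤ r d := by simpa [P] using hd
      have h2 : r (rev d) ≠ r d := fun h => hne d (r.injective h)
      have h3 := hval (rev d) (by simp [P, hrev d, lt_of_le_of_ne h1 h2])
      rw [hx d] at h3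
      simpa using h3
  have := LinearMap.finrank_le_finrank_of_injective hρ
  rwa [Module.finrank_fintype_fun_eq_card, Fintype.card_coe, hcard] at this

lemma card_le_finrank_range_coboundary [Fintype D] [Fintype V] {rev : D → D} {h : D → V}
    (hconst : ∀ f : V → ℚ, (∀ d, f (h (rev d)) = f (h d)) → ∀ u v, f u = f v) :
    Fintype.card V ≤ Module.finrank ℚ (LinearMap.range (coboundary rev h)) + 1 := by
  have hker : Module.finrank ℚ (LinearMap.ker (coboundary rev h)) ≤ 1 := by
    refine finrank_le_one ⟨1, ?_⟩ ?_
    · rw [LinearMap.mem_ker]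
      funext d
      simp [coboundary_apply]
    · rintro ⟨f, hf⟩
      rw [LinearMap.mem_ker] at hf
      have hf' := hconst f fun d => sub_eq_zero.1 (congrFun hf d)
      rcases isEmpty_or_nonempty V with hV | ⟨⟨v⟩⟩
      · exact ⟨0, Subtype.ext (funext fun v => hV.elim v)⟩
      · exact ⟨f v, Subtype.ext (funext fun u => by simp [hf' u v])⟩
  have := LinearMap.finrank_range_add_finrank_ker (coboundary rev h)
  rw [Module.finrank_fintype_fun_eq_card] at this
  omega

/-- If the coboundaries of two connected structures on `D` are orthogonal and satisfy Euler's
relation, then the antisymmetric functions orthogonal to the first kind of coboundaries are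
exactly the coboundaries of the second kind. -/
theorem exists_eq_coboundary [Fintype D] [Fintype V] [Fintype F] {rev : D → D}
    (hrev : Function.Involutive rev) (hne : ∀ d, rev d ≠ d) {h : D → V} {k : D → F}
    (hV : ∀ f : V → ℚ, (∀ d, f (h (rev d)) = f (h d)) → ∀ u v, f u = f v)
    (hF : ∀ g : F → ℚ, (∀ d, g (k (rev d)) = g (k d)) → ∀ u v, g u = g v)
    (horth : ∀ f g, coboundary rev h f ⬝ᵥ coboundary rev k g = 0)
    (hcard : Fintype.card V + Fintype.card F = Fintype.card D / 2 + 2)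
    {x : D → ℚ} (hx : ∀ d, x (rev d) = -x d) (hxV : ∀ f, x ⬝ᵥ coboundary rev h f = 0) :
    ∃ g, x = coboundary rev k g := by
  have hinf : LinearMap.range (coboundary rev h) ⊓ LinearMap.range (coboundary rev k) = ⊥ := by
    rw [eq_bot_iff]
    rintro _ ⟨⟨f, rfl⟩, ⟨g, hg⟩⟩
    have := horth f g
    rw [hg] at this
    exact dotProduct_self_eq_zero.1 this
  have hsup : LinearMap.range (coboundary rev h) ⊔ LinearMap.range (coboundary rev k) =
      antisymmetric rev := by
    refine Submodule.eq_of_le_of_finrank_le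
      (sup_le (range_coboundary_le hrev h) (range_coboundary_le hrev k)) ?_
    have h1 := Submodule.finrank_sup_add_finrank_inf_eq
      (LinearMap.range (coboundary rev h)) (LinearMap.range (coboundary rev k))
    rw [hinf, finrank_bot] at h1
    have h2 := card_le_finrank_range_coboundary hV
    have h3 := card_le_finrank_range_coboundary hF
    have h4 := finrank_antisymmetric_le hrev hne
    omega
  have hmem : x ∈ antisymmetric rev := hx
  rw [← hsup] at hmem
  obtain ⟨_, ⟨f, rfl⟩, _, ⟨g, rfl⟩, rfl⟩ := Submodule.mem_sup.1 hmem
  have hf := hxV f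
  rw [add_dotProduct, dotProduct_comm (coboundary rev k g), horth, add_zero,
    dotProduct_self_eq_zero] at hf
  exact ⟨g, by rw [hf, zero_add]⟩

lemma exists_int_of_eq_coboundary {rev : D → D} {k : D → F} {x : D → ℤ} {g : F → ℚ}
    (hg : (fun d => (x d : ℚ)) = coboundary rev k g) :
    ∃ g' : F → ℤ, ∀ d, x d = g' (k (rev d)) - g' (k d) := by
  refine ⟨fun v => ⌊g v⌋, fun d => ?_⟩
  have hd : g (k (rev d)) = g (k d) + x d := by
    rw [congrFun hg d, coboundary_apply]
    ring
  simp only [hd, Int.floor_add_intCast]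
  ring

end Coboundary

namespace Multigraph

variable (H : Multigraph)

lemma dotProduct_coboundary {x : H.D → ℚ} (hx : ∀ d, x (H.rev d) = -x d) (f : H.V → ℚ) :
    x ⬝ᵥ coboundary H.rev H.head f = -2 * ∑ d, x d * f (H.head d) := by
  have hrev : ∑ d, x d * f (H.head (H.rev d)) = -∑ d, x d * f (H.head d) := by
    rw [← Equiv.sum_comp H.rev_invol.toPerm, ← Finset.sum_neg_distrib]
    refine Finset.sum_congr rfl fun d _ => ?_
    simp [hx, H.rev_invol d]
  simp only [dotProduct, coboundary_apply, mul_sub, Finset.sum_sub_distrib, hrev]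
  ring

lemma bMap_eq_zero_iff {x : H.D → ℤ} (hx : x ∈ H.EdgeGroup) :
    H.bMap x = 0 ↔ ∀ f, (fun d => (x d : ℚ)) ⬝ᵥ coboundary H.rev H.head f = 0 := by
  have hx' : ∀ d, ((x (H.rev d) : ℤ) : ℚ) = -(x d : ℚ) := fun d => by rw [hx d]; simp
  simp only [H.dotProduct_coboundary (x := fun d => (x d : ℚ)) hx']
  constructor
  · intro hb f
    rw [← Finset.sum_fiberwise Finset.univ H.head]
    have : ∀ v, ∑ d ∈ Finset.univ.filter (fun d => H.head d = v), (x d : ℚ) * f (H.head d) = 0 := by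
      intro v
      have hv := congrFun hb v
      rw [bMap_apply, Pi.zero_apply] at hv
      rw [Finset.sum_congr rfl fun d hd => by rw [(Finset.mem_filter.1 hd).2],
        ← Finset.sum_mul, ← Int.cast_sum, hv]
      simp
    simp [this]
  · intro hf
    funext v
    have hv := hf (Pi.single v 1)
    simp only [Pi.single_apply, mul_ite, mul_one, mul_zero, ← Finset.sum_filter] at hv
    rw [bMap_apply, Pi.zero_apply]
    have : ((∑ d ∈ Finset.univ.filter (fun d => H.head d = v), x d : ℤ) : ℚ) = 0 := by
      push_cast
      linarith
    exact_mod_cast this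

theorem mem_cycleSpace_iff_exists {F : Type*} [Fintype F] (k : H.D → F)
    (hV : ∀ f : H.V → ℚ, (∀ d, f (H.head (H.rev d)) = f (H.head d)) → ∀ u v, f u = f v)
    (hF : ∀ g : F → ℚ, (∀ d, g (k (H.rev d)) = g (k d)) → ∀ u v, g u = g v)
    (horth : ∀ f g, coboundary H.rev H.head f ⬝ᵥ coboundary H.rev k g = 0)
    (hcard : Fintype.card H.V + Fintype.card F = Fintype.card H.D / 2 + 2) (x : H.D → ℤ) :
    x ∈ H.CycleSpace ↔ ∃ g : F → ℤ, ∀ d, x d = g (k (H.rev d)) - g (k d) := by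
  rw [mem_cycleSpace_iff]
  constructor
  · rintro ⟨hx, hb⟩
    obtain ⟨g, hg⟩ := exists_eq_coboundary H.rev_invol H.rev_ne hV hF horth hcard
      (x := fun d => (x d : ℚ)) (fun d => by rw [hx d]; simp) ((H.bMap_eq_zero_iff hx).1 hb)
    exact exists_int_of_eq_coboundary hg
  · rintro ⟨g, hg⟩
    have hx : x ∈ H.EdgeGroup := fun d => by rw [hg, hg, H.rev_invol]; ring
    refine ⟨hx, (H.bMap_eq_zero_iff hx).2 fun f => ?_⟩
    have : (fun d => (x d : ℚ)) = coboundary H.rev k fun v => (g v : ℚ) := by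
      funext d
      rw [coboundary_apply, hg]
      push_cast
      rfl
    rw [this, dotProduct_comm, horth]

lemma Connected.eq_of_forall {H : Multigraph} (hH : H.Connected) {A : Type*} (f : H.V → A)
    (hf : ∀ d, f (H.head (H.rev d)) = f (H.head d)) (u v : H.V) : f u = f v := by
  induction hH u v with
  | refl => rfl
  | tail _ hadj ih =>
    obtain ⟨d, rfl, rfl⟩ := hadj
    rw [ih, ← hf d]
    rfl

end Multigraph

namespace RibbonGraph

variable (G : RibbonGraph)

lemma leftFace_next (d : G.D) : G.leftFace (G.next d) = G.leftFace (G.rev d) := by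
  refine Quotient.sound ⟨-1, ?_⟩
  rw [zpow_neg_one, Equiv.Perm.inv_eq_iff_eq]
  change G.next d = G.next (G.rev (G.rev d))
  rw [G.rev_invol]

lemma eq_of_tail_eq {A : Type*} (φ : G.D → A) (hφ : ∀ d, φ (G.next d) = φ d) {d d' : G.D}
    (h : G.tail d = G.tail d') : φ d = φ d' := by
  obtain ⟨i, -, rfl⟩ := (G.next_cyclic d d' h).exists_pow_eq'
  clear h
  induction i with
  | zero => rfl
  | succ i ih => rw [pow_succ', Equiv.Perm.mul_apply, hφ, ih]

lemma eq_of_forall_leftFace (hG : G.Connected) {A : Type*} (g : G.Faces → A)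
    (hg : ∀ d, g (G.leftFace (G.rev d)) = g (G.leftFace d)) (a b : G.Faces) : g a = g b := by
  have hnext : ∀ d, g (G.leftFace (G.next d)) = g (G.leftFace d) := fun d => by
    rw [leftFace_next, hg]
  have hreach : ∀ d v, Relation.ReflTransGen G.Adj (G.tail d) v →
      ∀ d', G.tail d' = v → g (G.leftFace d) = g (G.leftFace d') := by
    intro d v hv
    induction hv with
    | refl => exact fun d' hd' => G.eq_of_tail_eq (fun d => g (G.leftFace d)) hnext hd'.symm
    | tail _ hadj ih =>
      obtain ⟨e, he, rfl⟩ := hadj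
      intro d' hd'
      rw [ih e he, ← hg e]
      exact G.eq_of_tail_eq (fun d => g (G.leftFace d)) hnext ((G.tail_rev_s11 e).trans hd'.symm)
  induction a using Quotient.inductionOn with | _ d
  induction b using Quotient.inductionOn with | _ d'
  exact hreach d _ (hG _ _) d' rfl

lemma coboundary_head_dotProduct_coboundary_leftFace (f : G.V → ℚ) (g : G.Faces → ℚ) :
    coboundary G.rev G.head f ⬝ᵥ coboundary G.rev G.leftFace g = 0 := by
  have hanti := range_coboundary_le G.rev_invol G.leftFace ⟨g, rfl⟩
  rw [dotProduct_comm, G.dotProduct_coboundary hanti, ← Equiv.sum_comp G.revPerm]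
  have hterm : ∀ d, coboundary G.rev G.leftFace g (G.revPerm d) * f (G.head (G.revPerm d)) =
      g (G.leftFace d) * f (G.tail d) - g (G.leftFace (G.next d)) * f (G.tail (G.next d)) := by
    intro d
    rw [leftFace_next, G.next_tail]
    change (g (G.leftFace (G.rev (G.rev d))) - g (G.leftFace (G.rev d))) * f (G.tail d) = _
    rw [G.rev_invol]
    ring
  simp only [hterm, Finset.sum_sub_distrib]
  rw [Equiv.sum_comp G.next fun d => g (G.leftFace d) * f (G.tail d)]
  simp

end RibbonGraph

/-- For a planar ribbon graph `G` with `G`, `G*` loopless, the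
map `ℤE → ℤE*`, `e ↦ e*`, carries the cycle space of `G` onto the cut space
of `G*` and the cut space of `G` onto the cycle space of `G*`, and induces a
group isomorphism `ℰ(G) ≅ ℰ(G*)`. -/
theorem dual_cycle_cut_spaces (G : RibbonGraph)
    (hconn : G.Connected) (hloop : G.Loopless) (hplanar : G.IsPlanar)
    (hdualloop : G.dual.Loopless) :
    G.CycleSpace = G.dual.CutSpace ∧ G.CutSpace = G.dual.CycleSpace ∧
    ∃ ψ : G.EGroup ≃+ G.dual.EGroup,
      ∀ d : G.D, ψ (G.eClass d) = G.dual.eClass d := by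
  have hV : ∀ f : G.V → ℚ, (∀ d, f (G.head (G.rev d)) = f (G.head d)) → ∀ u v, f u = f v :=
    hconn.eq_of_forall
  have hF : ∀ g : G.Faces → ℚ, (∀ d, g (G.leftFace (G.rev d)) = g (G.leftFace d)) →
      ∀ a b, g a = g b := G.eq_of_forall_leftFace hconn
  have horth := G.coboundary_head_dotProduct_coboundary_leftFace
  have hcycle : G.CycleSpace = G.dual.CutSpace := by
    ext x
    exact (G.mem_cycleSpace_iff_exists G.leftFace hV hF horth hplanar x).trans
      (G.dual.mem_cutSpace_iff x).symm
  have hcut : G.CutSpace = G.dual.CycleSpace := by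
    ext x
    exact (G.mem_cutSpace_iff x).trans
      (G.dual.mem_cycleSpace_iff_exists (F := G.V) G.head hF hV
        (fun g f => (dotProduct_comm _ _).trans (horth f g))
        ((add_comm _ _).trans hplanar) x).symm
  let e : G.EdgeGroup ≃+ G.dual.EdgeGroup := AddEquiv.refl G.EdgeGroup
  have hsum : (G.CycleSpace ⊔ G.CutSpace).addSubgroupOf G.EdgeGroup =
      (G.dual.CycleSpace ⊔ G.dual.CutSpace).addSubgroupOf G.dual.EdgeGroup := by
    rw [← hcycle, ← hcut, sup_comm]
    rfl
  exact ⟨hcycle, hcut,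
    QuotientAddGroup.congr _ ((G.dual.CycleSpace ⊔ G.dual.CutSpace).addSubgroupOf G.dual.EdgeGroup)
      e ((AddSubgroup.map_id _).trans hsum), fun d => rfl⟩
end
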